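/- arXiv:1502.06318 — 2 statements merged into one kernel-verified Lean document; each statement's English description precedes it below -/
import Mathlib

section
/- In every college admissions market with strict complete preference lists there exists a unique stable matching μ_C such that for every stable matching μ and every college c there is an injection g : μ(c) → μ_C(c) with g(s) = s or g(s) >_c s for every s ∈ μ(c). -/
/-- A college admissions market: capacities `q` (each at least 1) and, for every
student and every college, a strict complete preference list, modelled as a
`LinearOrder` in which *greater* means *more preferred*. -/
structure Market (S C : Type*) [Fintype S] [Fintype C] where
  q : C → ℕ
  q_pos : ∀ c, 1 ≤ q c
  sPref : S → LinearOrder C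
  cPref : C → LinearOrder S

variable {S C : Type*} [Fintype S] [Fintype C]

/-- Student `s` strictly prefers college `c` to college `c'`. -/
def Market.sprefers (M : Market S C) (s : S) (c c' : C) : Prop :=
  (M.sPref s).lt c' c

/-- College `c` strictly prefers student `s` to student `s'`. -/
def Market.cprefers (M : Market S C) (c : C) (s s' : S) : Prop :=
  (M.cPref c).lt s' s

/-- A matching: each college gets a set of students within its capacity, and the
sets of distinct colleges are disjoint (so each student has at most one college). -/
structure Matching (M : Market S C) where
  assign : C → Finset S
  card_le : ∀ c, (assign c).card ≤ M.q c
  disjoint : ∀ c c', c ≠ c' → Disjoint (assign c) (assign c')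

/-- `(s, c)` is a blocking pair: `s` is unmatched or prefers `c` to his current
college, and `c` has a free slot or prefers `s` to one of its current students. -/
def Blocks (M : Market S C) (μ : Matching M) (s : S) (c : C) : Prop :=
  (∀ c', s ∈ μ.assign c' → M.sprefers s c c') ∧
  ((μ.assign c).card < M.q c ∨ ∃ s' ∈ μ.assign c, M.cprefers c s s')

/-- A matching is stable if it admits no blocking pair. -/
def Stable (M : Market S C) (μ : Matching M) : Prop :=
  ∀ s c, ¬ Blocks M μ s c

/-- Student `s` weakly prefers his assignment under `μ` to his assignment under `ν`:
either the assignments coincide, or `s` is matched under `μ` to a college that he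
strictly prefers to his situation under `ν` (being matched beats being unmatched). -/
def SWeakPref (M : Market S C) (μ ν : Matching M) (s : S) : Prop :=
  (∀ c, s ∈ μ.assign c ↔ s ∈ ν.assign c) ∨
  ∃ c, s ∈ μ.assign c ∧
    ((∀ c', s ∉ ν.assign c') ∨ ∃ c', s ∈ ν.assign c' ∧ M.sprefers s c c')

/-- The student-optimal stable matching. -/
def StudentOptimal (M : Market S C) (μ : Matching M) : Prop :=
  Stable M μ ∧ ∀ ν : Matching M, Stable M ν → ∀ s, SWeakPref M μ ν s

/-- `X` (weakly) responsively dominates `Y` w.r.t. college `c`'s preferences: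
there is an injection `g : Y → X` with `g s = s` or `g s >_c s` for all `s ∈ Y`. -/
def RespDominates (M : Market S C) (c : C) (X Y : Finset S) : Prop :=
  ∃ g : S → S, Set.InjOn g ↑Y ∧ (∀ s ∈ Y, g s ∈ X) ∧
    ∀ s ∈ Y, g s = s ∨ M.cprefers c (g s) s

/-- Strict responsive domination. -/
def StrictRespDominates (M : Market S C) (c : C) (X Y : Finset S) : Prop :=
  X ≠ Y ∧ RespDominates M c X Y

/-- The college-optimal stable matching. -/
def CollegeOptimal (M : Market S C) (μ : Matching M) : Prop :=
  Stable M μ ∧ ∀ ν : Matching M, Stable M ν → ∀ c, RespDominates M c (μ.assign c) (ν.assign c)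

/-- The market in which college `c` reports the list `P` instead of its true list,
while everything else is unchanged. -/
def replaceCPref [DecidableEq C] (M : Market S C) (c : C) (P : LinearOrder S) :
    Market S C :=
  { M with cPref := Function.update M.cPref c P }

/-- The market in which student `s` reports the list `P` instead of his true list,
while everything else is unchanged. -/
def replaceSPref [DecidableEq S] (M : Market S C) (s : S) (P : LinearOrder C) :
    Market S C :=
  { M with sPref := Function.update M.sPref s P }

/-- Preferences of a student over the copies of the colleges in the associated
one-to-one market: copies of colleges are compared according to the student's order
over colleges, and within a block of copies smaller index is better. -/
def assocSPref (M : Market S C) (s : S) : LinearOrder ((c : C) × Fin (M.q c)) :=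
  letI := M.sPref s
  LinearOrder.lift' (fun x => toLex ((x.1 : C), (M.q x.1 - (x.2 : ℕ)))) (by
    rintro ⟨c, i⟩ ⟨c', j⟩ h
    have h' : ((c : C), M.q c - (i : ℕ)) = (c', M.q c' - (j : ℕ)) := toLex.injective h
    have h1 : c = c' := congrArg Prod.fst h'
    subst h1
    have h2 : M.q c - (i : ℕ) = M.q c - (j : ℕ) := congrArg Prod.snd h'
    have hi := i.isLt
    have hj := j.isLt
    have : (i : ℕ) = (j : ℕ) := by omega
    exact congrArg (Sigma.mk c) (Fin.ext this))

/-- The associated one-to-one market: college `c` is replaced by `q c` copies,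
each of capacity one and with `c`'s preferences over students; students' preferences
over copies are induced blockwise from their preferences over colleges. -/
def assocMarket (M : Market S C) : Market S ((c : C) × Fin (M.q c)) :=
  { q := fun _ => 1
    q_pos := fun _ => le_refl 1
    sPref := assocSPref M
    cPref := fun x => M.cPref x.1 }

section TopChoice

variable {α : Type*} [LinearOrder α]

/-- The `q` largest elements of `A` (all of `A` if it has at most `q` elements). -/
def topChoice (q : ℕ) (A : Finset α) : Finset α :=
  A.filter fun s => (A.filter fun t => s < t).card < q

theorem mem_topChoice {q : ℕ} {A : Finset α} {s : α} :
    s ∈ topChoice q A ↔ s ∈ A ∧ (A.filter fun t => s < t).card < q := by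
  simp [topChoice]

theorem card_topChoice_le (q : ℕ) (A : Finset α) : (topChoice q A).card ≤ q := by
  rcases (topChoice q A).eq_empty_or_nonempty with h | h
  · simp [h]
  · have hm := mem_topChoice.1 (Finset.min'_mem _ h)
    set m := (topChoice q A).min' h
    have hsub : topChoice q A ⊆ insert m (A.filter fun t => m < t) := by
      intro t ht
      have hle : m ≤ t := Finset.min'_le _ t ht
      rcases hle.eq_or_lt with rfl | hlt
      · simp
      · simp [hlt, (mem_topChoice.1 ht).1]
    have := Finset.card_le_card hsub
    have := Finset.card_insert_le m (A.filter fun t => m < t)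
    omega

theorem lt_of_mem_topChoice_of_notMem {q : ℕ} {A : Finset α} {s t : α} (hs : s ∈ A)
    (hs' : s ∉ topChoice q A) (ht : t ∈ topChoice q A) : s < t := by
  by_contra! hle
  refine hs' (mem_topChoice.2 ⟨hs, lt_of_le_of_lt (Finset.card_le_card ?_) (mem_topChoice.1 ht).2⟩)
  exact Finset.monotone_filter_right _ fun u _ hu => lt_of_le_of_lt hle hu

theorem card_topChoice_eq_of_notMem {q : ℕ} {A : Finset α} {s : α} (hs : s ∈ A)
    (hs' : s ∉ topChoice q A) : (topChoice q A).card = q := by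
  refine le_antisymm (card_topChoice_le q A) ?_
  have hne : (A \ topChoice q A).Nonempty := ⟨s, by simp [hs, hs']⟩
  have hm := Finset.mem_sdiff.1 (Finset.max'_mem _ hne)
  set m := (A \ topChoice q A).max' hne
  have hq : q ≤ (A.filter fun t => m < t).card := by
    by_contra! h
    exact hm.2 (mem_topChoice.2 ⟨hm.1, h⟩)
  refine hq.trans (Finset.card_le_card fun t ht => ?_)
  obtain ⟨htA, hlt⟩ := Finset.mem_filter.1 ht
  by_contra htop
  exact absurd (Finset.le_max' _ t (Finset.mem_sdiff.2 ⟨htA, htop⟩)) (not_le.2 hlt)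

/-- A chosen element is still chosen from every smaller set that contains it. -/
theorem mem_topChoice_of_subset {q : ℕ} {A B : Finset α} {s : α} (hBA : B ⊆ A) (hsB : s ∈ B)
    (hs : s ∈ topChoice q A) : s ∈ topChoice q B :=
  mem_topChoice.2 ⟨hsB, lt_of_le_of_lt
    (Finset.card_le_card (Finset.filter_subset_filter _ hBA)) (mem_topChoice.1 hs).2⟩

theorem card_lt_or_exists_lt_of_mem_topChoice {q : ℕ} {A B : Finset α} {s : α} (hBA : B ⊆ A)
    (hs : s ∈ topChoice q A) (hsB : s ∉ B) : B.card < q ∨ ∃ t ∈ B, t < s := by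
  by_contra! h
  refine absurd (mem_topChoice.1 hs).2 (not_lt.2 (h.1.trans (Finset.card_le_card fun t ht => ?_)))
  exact Finset.mem_filter.2 ⟨hBA ht, lt_of_le_of_ne (h.2 t ht) fun e => hsB (e ▸ ht)⟩

theorem exists_injOn_topChoice {q : ℕ} {A B : Finset α} (hBA : B ⊆ A) (hB : B.card ≤ q) :
    ∃ g : α → α, Set.InjOn g ↑B ∧ (∀ s ∈ B, g s ∈ topChoice q A) ∧
      ∀ s ∈ B, g s = s ∨ s < g s := by
  have hcard : (B \ topChoice q A).card ≤ (topChoice q A \ B).card := by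
    rcases (B \ topChoice q A).eq_empty_or_nonempty with h | ⟨s, hs⟩
    · simp [h]
    · rw [Finset.mem_sdiff] at hs
      have := card_topChoice_eq_of_notMem (hBA hs.1) hs.2
      exact Finset.card_sdiff_le_card_sdiff_iff.2 (by omega)
  obtain ⟨f, hf, hfi⟩ : ∃ f : α → α, Set.MapsTo f ↑(B \ topChoice q A) ↑(topChoice q A \ B) ∧
      Set.InjOn f ↑(B \ topChoice q A) := by
    rcases (B \ topChoice q A).eq_empty_or_nonempty with h | ⟨s, hs⟩
    · exact ⟨id, by rw [h]; simp [Set.MapsTo], by simp [h]⟩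
    · have : Nonempty α := ⟨s⟩
      have hle : (↑(B \ topChoice q A) : Set α).encard ≤
          (↑(topChoice q A \ B) : Set α).encard := by
        simpa only [Set.encard_coe_eq_coe_finsetCard, Nat.cast_le] using hcard
      exact (Finset.finite_toSet _).exists_injOn_of_encard_le hle
  refine ⟨fun s => if s ∈ topChoice q A then s else f s, ?_, ?_, ?_⟩
  · intro s hs t ht hst
    have hfs : s ∉ topChoice q A → f s ∉ B := fun h =>
      (Finset.mem_sdiff.1 (hf (Finset.mem_coe.2 (Finset.mem_sdiff.2 ⟨hs, h⟩)))).2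
    have hft : t ∉ topChoice q A → f t ∉ B := fun h =>
      (Finset.mem_sdiff.1 (hf (Finset.mem_coe.2 (Finset.mem_sdiff.2 ⟨ht, h⟩)))).2
    by_cases h1 : s ∈ topChoice q A <;> by_cases h2 : t ∈ topChoice q A <;>
      simp only [h1, h2, if_true, if_false] at hst
    · exact hst
    · exact absurd (hst ▸ hs) (hft h2)
    · exact absurd (hst ▸ ht) (hfs h1)
    · exact hfi (Finset.mem_coe.2 (Finset.mem_sdiff.2 ⟨hs, h1⟩))
        (Finset.mem_coe.2 (Finset.mem_sdiff.2 ⟨ht, h2⟩)) hst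
  · intro s hs
    by_cases h : s ∈ topChoice q A
    · simp [h]
    · simpa [h] using (Finset.mem_sdiff.1 (hf (Finset.mem_coe.2 (Finset.mem_sdiff.2 ⟨hs, h⟩)))).1
  · intro s hs
    by_cases h : s ∈ topChoice q A
    · simp [h]
    · right
      simpa [h] using lt_of_mem_topChoice_of_notMem (hBA hs) h
        (Finset.mem_sdiff.1 (hf (Finset.mem_coe.2 (Finset.mem_sdiff.2 ⟨hs, h⟩)))).1

/-- Two finite sets with increasing injections in both directions are nested: the composite is an
increasing permutation of `Y`, hence the identity. -/
theorem subset_of_injOn_le_of_injOn_le {X Y : Finset α} {g h : α → α}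
    (hg : Set.InjOn g ↑Y) (hgX : ∀ s ∈ Y, g s ∈ X) (hgle : ∀ s ∈ Y, s ≤ g s)
    (hh : Set.InjOn h ↑X) (hhY : ∀ s ∈ X, h s ∈ Y) (hhle : ∀ s ∈ X, s ≤ h s) : Y ⊆ X := by
  have hinj : Set.InjOn (h ∘ g) ↑Y := hh.comp hg fun s hs => hgX s hs
  have himg : Y.image (h ∘ g) = Y := by
    refine Finset.eq_of_subset_of_card_le ?_ (Finset.card_image_of_injOn hinj).ge
    intro t ht
    obtain ⟨s, hs, rfl⟩ := Finset.mem_image.1 ht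
    exact hhY _ (hgX s hs)
  let r : α → ℕ := fun s => (Y.filter fun t => t < s).card
  have hle : ∀ s ∈ Y, s ≤ h (g s) := fun s hs => (hgle s hs).trans (hhle _ (hgX s hs))
  have hr : ∀ s ∈ Y, r s ≤ r (h (g s)) := fun s hs =>
    Finset.card_le_card (Finset.monotone_filter_right _ fun t _ ht => lt_of_lt_of_le ht (hle s hs))
  have hsum : ∑ s ∈ Y, r s = ∑ s ∈ Y, r (h (g s)) := by
    conv_lhs => rw [← himg, Finset.sum_image hinj]
    rfl
  intro s hs
  have heq := (Finset.sum_eq_sum_iff_of_le hr).1 hsum s hs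
  have hfix : h (g s) = s := by
    by_contra hne
    have hlt : s < h (g s) := lt_of_le_of_ne (hle s hs) (Ne.symm hne)
    refine absurd heq (ne_of_lt (Finset.card_lt_card (Finset.ssubset_iff_of_subset
      (Finset.monotone_filter_right _ fun t _ ht => lt_trans ht hlt) |>.2 ⟨s, ?_, ?_⟩)))
    · simp [hs, hlt]
    · simp
  have : g s = s := le_antisymm ((hhle _ (hgX s hs)).trans hfix.le) (hgle s hs)
  exact this ▸ hgX s hs

end TopChoice

section DeferredAcceptance

variable (M : Market S C)

open Classical in
/-- The students who have not yet rejected college `c`, given the set `R` of rejections. -/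
noncomputable def available (R : Set (S × C)) (c : C) : Finset S :=
  Finset.univ.filter fun s => (s, c) ∉ R

theorem mem_available {S C : Type*} [Fintype S] {R : Set (S × C)} {c : C} {s : S} :
    s ∈ available R c ↔ (s, c) ∉ R := by
  simp [available]

/-- The students to whom college `c` makes an offer, given the set `R` of rejections. -/
noncomputable def offers (R : Set (S × C)) (c : C) : Finset S :=
  letI := M.cPref c
  topChoice (M.q c) (available R c)

/-- A set of rejections that no stable matching violates and in which every rejection is
justified by a better current offer. -/
structure JustifiedRejections (R : Set (S × C)) : Prop where
  not_mem_stable : ∀ s c, (s, c) ∈ R → ∀ μ : Matching M, Stable M μ → s ∉ μ.assign c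
  exists_better_offer : ∀ s c, (s, c) ∈ R → ∃ c', s ∈ offers M R c' ∧ M.sprefers s c' c

/-- The rejections in `R` together with those of all offers worse than another current offer. -/
def rejectionStep (R : Set (S × C)) : Set (S × C) :=
  R ∪ {p | ∃ c', p.1 ∈ offers M R c' ∧ M.sprefers p.1 c' p.2}

variable {M}

theorem notMem_of_mem_offers {R : Set (S × C)} {c : C} {s : S} (hs : s ∈ offers M R c) :
    (s, c) ∉ R := by
  let _ := M.cPref c
  exact mem_available.1 (mem_topChoice.1 hs).1

theorem JustifiedRejections.assign_subset {R : Set (S × C)} (hR : JustifiedRejections M R)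
    {μ : Matching M} (hμ : Stable M μ) (c : C) : μ.assign c ⊆ available R c :=
  fun s hs => mem_available.2 fun h => hR.not_mem_stable s c h μ hμ hs

theorem Matching.eq_of_mem (μ : Matching M) {s : S} {c c' : C} (h : s ∈ μ.assign c)
    (h' : s ∈ μ.assign c') : c = c' := by
  by_contra hne
  exact Finset.disjoint_left.1 (μ.disjoint c c' hne) h h'

theorem JustifiedRejections.step {R : Set (S × C)} (hR : JustifiedRejections M R) :
    JustifiedRejections M (rejectionStep M R) where
  not_mem_stable := by
    rintro s c (h | ⟨c', hc', hlt⟩) μ hμ hs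
    · exact hR.not_mem_stable s c h μ hμ hs
    · refine hμ s c' ⟨fun d hd => μ.eq_of_mem hs hd ▸ hlt, ?_⟩
      have hsc' : s ∉ μ.assign c' := fun h => by
        let _ := M.sPref s
        obtain rfl := μ.eq_of_mem hs h
        exact lt_irrefl c hlt
      let _ := M.cPref c'
      exact card_lt_or_exists_lt_of_mem_topChoice (hR.assign_subset hμ c') hc' hsc'
  exists_better_offer := by
    intro s c h
    let _ := M.sPref s
    obtain ⟨c', hc', hlt⟩ : ∃ c', s ∈ offers M R c' ∧ M.sprefers s c' c :=
      h.elim (hR.exists_better_offer s c) id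
    obtain ⟨d, hcd, hd⟩ := (Set.toFinite {d | s ∈ offers M R d}).exists_le_maximal hc'
    refine ⟨d, ?_, lt_of_lt_of_le hlt hcd⟩
    have hsd : (s, d) ∉ rejectionStep M R := by
      rintro (h | ⟨e, he, hde⟩)
      · exact notMem_of_mem_offers hd.prop h
      · exact absurd hde (hd.not_gt he)
    let _ := M.cPref d
    refine mem_topChoice_of_subset (fun t ht => ?_) (mem_available.2 hsd) hd.prop
    exact mem_available.2 fun h => mem_available.1 ht (Or.inl h)

variable (M) in
theorem exists_justifiedRejections_closed : ∃ R : Set (S × C), JustifiedRejections M R ∧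
    ∀ s c c', s ∈ offers M R c' → M.sprefers s c' c → (s, c) ∈ R := by
  obtain ⟨R, hR⟩ := (Set.toFinite {R : Set (S × C) | JustifiedRejections M R}).exists_maximal
    ⟨∅, ⟨by simp, by simp⟩⟩
  have hRj : JustifiedRejections M R := hR.prop
  refine ⟨R, hRj, fun s c c' h hlt => ?_⟩
  exact hR.le_of_ge hRj.step Set.subset_union_left (Or.inr ⟨c', h, hlt⟩)

variable (M) in
theorem exists_collegeOptimal : ∃ μ : Matching M, CollegeOptimal M μ := by
  obtain ⟨R, hR, hclosed⟩ := exists_justifiedRejections_closed M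
  refine ⟨⟨offers M R, fun c => ?_, fun c c' hne => ?_⟩, fun s c hb => ?_, fun ν hν c => ?_⟩
  · let _ := M.cPref c
    exact card_topChoice_le _ _
  · refine Finset.disjoint_left.2 fun s hs hs' => ?_
    let _ := M.sPref s
    rcases lt_or_gt_of_ne hne with h | h
    · exact notMem_of_mem_offers hs (hclosed s c c' hs' h)
    · exact notMem_of_mem_offers hs' (hclosed s c' c hs h)
  · obtain ⟨hbs, hbc⟩ := hb
    have hsc : s ∉ offers M R c := fun h => by
      let _ := M.sPref s
      exact lt_irrefl c (hbs c h)
    by_cases hsR : (s, c) ∈ R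
    · obtain ⟨c', hc', hlt⟩ := hR.exists_better_offer s c hsR
      let _ := M.sPref s
      exact lt_asymm (hbs c' hc') hlt
    · let _ := M.cPref c
      have hs := mem_available.2 hsR
      rcases hbc with h | ⟨t, ht, hlt⟩
      · exact h.ne (card_topChoice_eq_of_notMem hs hsc)
      · exact lt_asymm hlt (lt_of_mem_topChoice_of_notMem hs hsc ht)
  · let _ := M.cPref c
    exact exists_injOn_topChoice (hR.assign_subset hν c) (ν.card_le c)

theorem RespDominates.subset {c : C} {X Y : Finset S} (hXY : RespDominates M c X Y)
    (hYX : RespDominates M c Y X) : Y ⊆ X := by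
  obtain ⟨g, hg, hgX, hgle⟩ := hXY
  obtain ⟨h, hh, hhY, hhle⟩ := hYX
  let _ := M.cPref c
  exact subset_of_injOn_le_of_injOn_le hg hgX
    (fun s hs => (hgle s hs).elim (fun e => e.ge) fun hlt => le_of_lt hlt) hh hhY
    (fun s hs => (hhle s hs).elim (fun e => e.ge) fun hlt => le_of_lt hlt)

theorem CollegeOptimal.unique {μ ν : Matching M} (hμ : CollegeOptimal M μ)
    (hν : CollegeOptimal M ν) : μ = ν := by
  have h : μ.assign = ν.assign := funext fun c => Finset.Subset.antisymm
    ((hν.2 μ hμ.1 c).subset (hμ.2 ν hν.1 c)) ((hμ.2 ν hν.1 c).subset (hν.2 μ hμ.1 c))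
  cases μ
  cases ν
  congr

end DeferredAcceptance

/-- Existence of a unique college-optimal stable matching: a stable
matching `μC` such that for every stable matching `μ` and every college `c` there is
an injection `g : μ(c) → μC(c)` with `g s = s` or `g s >_c s` for every `s ∈ μ(c)`. -/
theorem stmt_2 {S C : Type*} [Fintype S] [Fintype C] (M : Market S C) :
    ∃! μC : Matching M, Stable M μC ∧
      ∀ μ : Matching M, Stable M μ → ∀ c : C,
        ∃ g : S → S, Set.InjOn g ↑(μ.assign c) ∧
          (∀ s ∈ μ.assign c, g s ∈ μC.assign c) ∧
          ∀ s ∈ μ.assign c, g s = s ∨ M.cprefers c (g s) s := by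
  obtain ⟨μ, hμ⟩ := exists_collegeOptimal M
  exact ⟨μ, hμ, fun ν hν => CollegeOptimal.unique hν hμ⟩
end

section
/- Let μ and μ' be the truthful and manipulated outcomes of a beneficial manipulation by a college c of the student-optimal stable mechanism, and set T = μ(c) \ μ'(c) and S* = μ'(c) \ μ(c). Then |μ'(c)| = |μ(c)|, hence |T| = |S*|, and there exists a bijection ψ : T → S* such that ψ(t) >_c t for every t ∈ T (with respect to c's true preference order). -/
variable {S C : Type*} [Fintype S] [Fintype C]

/-- An injection `Y → X` moving every element up along a transitive relation `r` induces such an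
injection after deleting from both sides any set `Z` of common elements. -/
theorem exists_injOn_sdiff_of_injOn {α : Type*} [DecidableEq α] {r : α → α → Prop}
    (htrans : ∀ a b d, r a b → r b d → r a d) {X Y : Finset α} {g : α → α}
    (hinj : Set.InjOn g ↑Y) (hmaps : ∀ y ∈ Y, g y ∈ X) (hr : ∀ y ∈ Y, r y (g y))
    (Z : Finset α) (hZ : Z ⊆ Y) :
    ∃ f : α → α, Set.InjOn f ↑(Y \ Z) ∧ (∀ y ∈ Y \ Z, f y ∈ X \ Z) ∧
      ∀ y ∈ Y \ Z, r y (f y) := by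
  induction Z using Finset.induction_on with
  | empty => exact ⟨g, by simpa using hinj, by simpa using hmaps, by simpa using hr⟩
  | insert x Z hx ih =>
    obtain ⟨f, hfinj, hfmaps, hfr⟩ := ih ((Finset.subset_insert x Z).trans hZ)
    have hxY : x ∈ Y \ Z := Finset.mem_sdiff.2 ⟨hZ (Finset.mem_insert_self x Z), hx⟩
    have hsub : ∀ y ∈ Y \ insert x Z, y ∈ Y \ Z ∧ y ≠ x := by
      intro y hy
      simp only [Finset.mem_sdiff, Finset.mem_insert, not_or] at hy ⊢
      exact ⟨⟨hy.1, hy.2.2⟩, hy.2.1⟩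
    refine ⟨fun y => if f y = x then f x else f y, ?_, ?_, ?_⟩
    · intro a ha b hb hab
      obtain ⟨ha, hax⟩ := hsub a ha
      obtain ⟨hb, hbx⟩ := hsub b hb
      have hinj' : ∀ u ∈ Y \ Z, ∀ v ∈ Y \ Z, f u = f v → u = v :=
        fun u hu v hv h => hfinj hu hv h
      grind
    · intro y hy
      obtain ⟨hy, hyx⟩ := hsub y hy
      have hne : f y ≠ f x := fun h => hyx (hfinj hy hxY h)
      have hfy := hfmaps y hy
      have hfx := hfmaps x hxY
      grind
    · intro y hy
      obtain ⟨hy, -⟩ := hsub y hy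
      dsimp only
      split_ifs with h
      · exact htrans _ _ _ (hfr y hy) (h ▸ hfr x hxY)
      · exact hfr y hy

/-- Responsive domination between sets of equal size is witnessed by a strictly improving
bijection between the two set differences. -/
theorem RespDominates.exists_bijOn_sdiff [DecidableEq S] {M : Market S C} {c : C} {X Y : Finset S}
    (h : RespDominates M c X Y) (hcard : X.card = Y.card) :
    ∃ ψ : S → S, Set.BijOn ψ ↑(Y \ X) ↑(X \ Y) ∧ ∀ t ∈ Y \ X, M.cprefers c (ψ t) t := by
  obtain ⟨g, hinj, hmaps, hg⟩ := h
  obtain ⟨f, hfinj, hfmaps, hfg⟩ := exists_injOn_sdiff_of_injOn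
    (r := fun a b => b = a ∨ M.cprefers c b a)
    (by
      rintro a b d (rfl | hab) (rfl | hbd)
      · exact Or.inl rfl
      · exact Or.inr hbd
      · exact Or.inr hab
      · let := M.cPref c
        exact Or.inr (lt_trans (α := S) hab hbd))
    hinj hmaps hg (X ∩ Y) Finset.inter_subset_right
  rw [Finset.sdiff_inter_self_right] at hfinj hfmaps hfg
  rw [Finset.sdiff_inter_self_left] at hfmaps
  refine ⟨f, ⟨fun t ht => hfmaps t ht, hfinj, ?_⟩, fun t ht => ?_⟩
  · exact Finset.surjOn_of_injOn_of_card_le f (fun t ht => hfmaps t ht) hfinj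
      (Finset.card_sdiff_comm hcard).le
  · refine (hfg t ht).resolve_left fun heq => ?_
    have hft := hfmaps t ht
    rw [heq] at hft
    exact (Finset.mem_sdiff.1 hft).2 (Finset.mem_sdiff.1 ht).1

/-- If `c` has a free slot in a stable matching, no student prefers `c` to his assignment. -/
theorem Stable.not_forall_sprefers_of_card_lt {M : Market S C} {μ : Matching M}
    (h : Stable M μ) {c : C} (hc : (μ.assign c).card < M.q c) (s : S) :
    ¬ ∀ c', s ∈ μ.assign c' → M.sprefers s c c' :=
  fun hs => h s c ⟨hs, Or.inl hc⟩

/-- A matching of `M`, viewed as a matching of the market with `c`'s list replaced. -/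
def Matching.toReplaceCPref [DecidableEq C] {M : Market S C} (μ : Matching M) (c : C)
    (P : LinearOrder S) : Matching (replaceCPref M c P) :=
  ⟨μ.assign, μ.card_le, μ.disjoint⟩

/-- A stable matching in which `c` has a free slot stays stable whatever list `c` reports. -/
theorem Stable.toReplaceCPref [DecidableEq C] {M : Market S C} {μ : Matching M}
    (h : Stable M μ) {c : C} (hc : (μ.assign c).card < M.q c) (P : LinearOrder S) :
    Stable (replaceCPref M c P) (μ.toReplaceCPref c P) := by
  rintro s d ⟨hs, hd⟩
  by_cases hdc : d = c
  · subst hdc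
    exact h.not_forall_sprefers_of_card_lt hc s hs
  · refine h s d ⟨hs, hd.imp id ?_⟩
    have hpref : (replaceCPref M c P).cPref d = M.cPref d := Function.update_of_ne hdc _ _
    rintro ⟨s', hs', hlt⟩
    refine ⟨s', hs', ?_⟩
    rwa [Market.cprefers, hpref] at hlt

/-- If `c` has a free slot in a stable matching of the true market, then misreporting can only
shrink the set of students it receives under the student-optimal stable mechanism. -/
theorem StudentOptimal.assign_subset_of_card_lt [DecidableEq C] {M : Market S C} {c : C}
    {P : LinearOrder S} {μ : Matching M} {μ' : Matching (replaceCPref M c P)}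
    (hμ : Stable M μ) (hμ' : StudentOptimal (replaceCPref M c P) μ')
    (hc : (μ.assign c).card < M.q c) : μ'.assign c ⊆ μ.assign c := by
  intro s hs
  rcases hμ'.2 _ (hμ.toReplaceCPref hc P) s with heq | ⟨d, hd, hbetter⟩
  · exact (heq c).1 hs
  · have hdc : d = c := by
      by_contra hne
      exact Finset.disjoint_left.1 (μ'.disjoint d c hne) hd hs
    subst hdc
    refine absurd ?_ (hμ.not_forall_sprefers_of_card_lt hc s)
    intro c' hc'
    rcases hbetter with hun | ⟨e, he, hlt⟩
    · exact absurd hc' (hun c')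
    · have hec : e = c' := by
        by_contra hne
        exact Finset.disjoint_left.1 (μ.disjoint e c' hne) he hc'
      exact hec ▸ hlt

/-- For a beneficial manipulation of the student-optimal stable
mechanism by college `c` with truthful outcome `μ` and manipulated outcome `μ'`,
setting `T = μ(c) \\ μ'(c)` and `S* = μ'(c) \\ μ(c)`, we have `|μ'(c)| = |μ(c)|`
(hence `|T| = |S*|`) and there is a bijection `ψ : T → S*` with `ψ t >_c t` for all
`t ∈ T` w.r.t. `c`'s true preferences. -/
theorem stmt_6 {S C : Type*} [Fintype S] [Fintype C] [DecidableEq S] [DecidableEq C]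
    (M : Market S C) (c : C) (P : LinearOrder S)
    (μ : Matching M) (μ' : Matching (replaceCPref M c P))
    (hμ : StudentOptimal M μ) (hμ' : StudentOptimal (replaceCPref M c P) μ')
    (hben : StrictRespDominates M c (μ'.assign c) (μ.assign c)) :
    (μ'.assign c).card = (μ.assign c).card ∧
    ∃ ψ : S → S,
      Set.BijOn ψ ↑(μ.assign c \ μ'.assign c) ↑(μ'.assign c \ μ.assign c) ∧
      ∀ t ∈ μ.assign c \ μ'.assign c, M.cprefers c (ψ t) t := by
  obtain ⟨hne, hdom⟩ := hben
  have hle : (μ.assign c).card ≤ (μ'.assign c).card := by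
    obtain ⟨g, hinj, hmaps, -⟩ := hdom
    exact Finset.card_le_card_of_injOn g hmaps hinj
  have hcard : (μ'.assign c).card = (μ.assign c).card := by
    rcases (μ.card_le c).lt_or_eq with hlt | heq
    · exact absurd (Finset.eq_of_subset_of_card_le
        (StudentOptimal.assign_subset_of_card_lt hμ.1 hμ' hlt) hle) hne
    · exact le_antisymm ((μ'.card_le c).trans heq.ge) hle
  exact ⟨hcard, hdom.exists_bijOn_sdiff hcard⟩
end
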